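/- Let n > k ≥ 2 be integers with n odd and k even. Then the domination polynomial of the (k,n)-star has no nonzero real root: for every real number x ≠ 0, D(S_{k,n−k}, x) ≠ 0. -/

import Mathlib

open Polynomial

/-- `S` is a dominating set of `G`. -/
def IsDomSet {V : Type*} (G : SimpleGraph V) (S : Finset V) : Prop :=
  ∀ v : V, v ∉ S → ∃ u ∈ S, G.Adj u v

/-- The domination number of `G`. -/
noncomputable def domNum {V : Type*} [Fintype V] (G : SimpleGraph V) : ℕ :=
  sInf {i : ℕ | ∃ S : Finset V, IsDomSet G S ∧ S.card = i}

open scoped Classical in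
/-- The domination polynomial of `G`, `D(G,x) = Σ_S x^{|S|}` over dominating sets `S`. -/
noncomputable def domPoly {V : Type*} [Fintype V] (G : SimpleGraph V) : Polynomial ℤ :=
  ∑ S ∈ Finset.univ.filter (fun S : Finset V => IsDomSet G S), (X : Polynomial ℤ) ^ S.card

/-- The `(k,n)`-path: vertices `v_1,…,v_n`, distinct `v_i, v_j` adjacent iff `|i-j| ≤ k`. -/
def kPath (k n : ℕ) : SimpleGraph (Fin n) :=
  SimpleGraph.fromRel (fun i j => |(i.val : ℤ) - (j.val : ℤ)| ≤ (k : ℤ))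

/-- The `(k,n)`-cycle: distinct `v_i, v_j` adjacent iff `|i-j| ≤ k` or `{i,j} = {1,n}`. -/
def kCycle (k n : ℕ) : SimpleGraph (Fin n) :=
  SimpleGraph.fromRel (fun i j =>
    |(i.val : ℤ) - (j.val : ℤ)| ≤ (k : ℤ) ∨ |(i.val : ℤ) - (j.val : ℤ)| = (n : ℤ) - 1)

/-- The `(k,n)`-wheel: the `(k,n)`-cycle joined with one extra vertex (the last vertex,
of index `n`) adjacent to all others. -/
def kWheel (k n : ℕ) : SimpleGraph (Fin (n + 1)) :=
  SimpleGraph.fromRel (fun i j =>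
    (i.val < n ∧ j.val < n ∧
      (|(i.val : ℤ) - (j.val : ℤ)| ≤ (k : ℤ) ∨ |(i.val : ℤ) - (j.val : ℤ)| = (n : ℤ) - 1)) ∨
    j.val = n)

/-- The `(k,n)`-star on `n` vertices: `K_k + \bar K_{n-k}`; the first `k` vertices form a
clique, the rest are independent, and every clique vertex is joined to every other vertex. -/
def kStar (k n : ℕ) : SimpleGraph (Fin n) :=
  SimpleGraph.fromRel (fun i _ => i.val < k)

/-- The corona `G ∘ H`. -/
def corona {V W : Type*} (G : SimpleGraph V) (H : SimpleGraph W) :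
    SimpleGraph (V ⊕ V × W) :=
  SimpleGraph.fromRel (fun a b =>
    (∃ u v, a = Sum.inl u ∧ b = Sum.inl v ∧ G.Adj u v) ∨
    (∃ u w w', a = Sum.inr (u, w) ∧ b = Sum.inr (u, w') ∧ H.Adj w w') ∨
    (∃ u w, a = Sum.inl u ∧ b = Sum.inr (u, w)))

/-- A set of vertices of the `(k,n)`-star is dominating iff it meets the clique or is exactly
the independent part. -/
lemma isDomSet_kStar_iff {k n : ℕ} (hn : k < n) (S : Finset (Fin n)) :
    IsDomSet (kStar k n) S ↔
      (¬ S ⊆ Finset.univ.filter fun i : Fin n => k ≤ i.val) ∨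
        S = Finset.univ.filter fun i : Fin n => k ≤ i.val := by
  constructor
  · intro h
    by_contra! hc
    obtain ⟨hsub, hne⟩ := hc
    refine hne (Finset.Subset.antisymm hsub fun v hv => ?_)
    by_contra hvS
    obtain ⟨u, hu, hadj⟩ := h v hvS
    have hu' := hsub hu
    simp only [Finset.mem_filter, Finset.mem_univ, true_and] at hu' hv
    simp only [kStar, SimpleGraph.fromRel_adj] at hadj
    omega
  · rintro (h | rfl) v hv
    · obtain ⟨u, hu, huk⟩ := Finset.not_subset.mp h
      simp only [Finset.mem_filter, Finset.mem_univ, true_and, not_le] at huk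
      refine ⟨u, hu, ?_⟩
      simp only [kStar, SimpleGraph.fromRel_adj]
      exact ⟨fun huv => hv (huv ▸ hu), Or.inl huk⟩
    · simp only [Finset.mem_filter, Finset.mem_univ, true_and, not_le] at hv
      refine ⟨⟨k, hn⟩, by simp, ?_⟩
      simp only [kStar, SimpleGraph.fromRel_adj]
      refine ⟨fun huv => ?_, Or.inr hv⟩
      rw [← huv] at hv
      exact lt_irrefl _ hv

lemma sum_powerset_pow_card {α R : Type*} [CommSemiring R] (s : Finset α) (x : R) :
    ∑ t ∈ s.powerset, x ^ t.card = (1 + x) ^ s.card := by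
  simpa [add_comm] using Finset.sum_pow_mul_eq_add_pow x 1 s

/-- The domination polynomial of the `(k,n)`-star. -/
lemma domPoly_kStar {k n : ℕ} (hn : k < n) :
    domPoly (kStar k n) = (1 + X) ^ n - (1 + X) ^ (n - k) + X ^ (n - k) := by
  classical
  set B : Finset (Fin n) := Finset.univ.filter fun i : Fin n => k ≤ i.val with hB
  have hcard : B.card = n - k := by
    have h : B = Finset.Ici ⟨k, hn⟩ := by ext i; simp [hB, Fin.le_def]
    rw [h, Fin.card_Ici]
  have hset : (Finset.univ.filter fun S : Finset (Fin n) => IsDomSet (kStar k n) S) =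
      insert B (Finset.univ \ B.powerset) := by
    ext S
    simp [isDomSet_kStar_iff hn, ← hB, or_comm]
  have hdiff := Finset.sum_sdiff (f := fun S : Finset (Fin n) => (X : Polynomial ℤ) ^ S.card)
    (Finset.subset_univ B.powerset)
  rw [← Finset.powerset_univ, sum_powerset_pow_card, sum_powerset_pow_card, hcard,
    Finset.card_univ, Fintype.card_fin, Finset.powerset_univ] at hdiff
  have hdom : domPoly (kStar k n) =
      ∑ S ∈ insert B (Finset.univ \ B.powerset), (X : Polynomial ℤ) ^ S.card := by
    rw [← hset, domPoly]
  rw [hdom, Finset.sum_insert (by simp), hcard, ← hdiff]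
  ring

theorem kStar_no_nonzero_real_root (k n : ℕ) (hk : 2 ≤ k) (hn : k < n)
    (hnodd : Odd n) (hkeven : Even k) :
    ∀ x : ℝ, x ≠ 0 → Polynomial.aeval x (domPoly (kStar k n)) ≠ 0 := by
  intro x hx
  rw [domPoly_kStar hn]
  simp only [map_add, map_sub, map_pow, map_one, aeval_X]
  have hm : Odd (n - k) := Nat.Odd.sub_even hn.le hnodd hkeven
  rcases lt_or_gt_of_ne hx with hneg | hpos
  · refine ne_of_lt ?_
    rcases le_or_gt 0 (1 + x) with hy | hy
    · have h1 : (1 + x) ^ n ≤ (1 + x) ^ (n - k) :=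
        pow_le_pow_of_le_one hy (by linarith) (Nat.sub_le n k)
      have h2 : x ^ (n - k) < 0 := hm.pow_neg hneg
      linarith
    · have h1 : (1 + x) ^ n < 0 := hnodd.pow_neg hy
      have h2 : x ^ (n - k) < (1 + x) ^ (n - k) := hm.strictMono_pow (by linarith)
      linarith
  · refine ne_of_gt ?_
    have h1 : (1 + x) ^ (n - k) ≤ (1 + x) ^ n :=
      pow_le_pow_right₀ (by linarith) (Nat.sub_le n k)
    have h2 : 0 < x ^ (n - k) := pow_pos hpos _
    linarith
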